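/- Let m ≥ 2 and let M and M' be m-Hadamardesque matrices (of sizes m × n and m × n' respectively) with Column Representation Vectors v and v'. Then M and M' have the same pairwise row dot products (i.e. for all 1 ≤ i < j ≤ m, the dot product of the i-th and j-th rows of M equals that of the i-th and j-th rows of M') if and only if v - v' lies in the linear span of RC_m. -/

import Mathlib

open Matrix
open scoped Classical

/-- `pidx i j` is the 0-indexed position of the pair `(i,j)`, `i < j`, in the standard
ordering `(0,1),(0,2),(1,2),(0,3),...`; it corresponds to the 1-indexed position
`(j-1)(j-2)/2 + i` of the paper (for 1-indexed pairs `1 ≤ i < j ≤ m`). -/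
def pidx (i j : ℕ) : ℕ := j * (j - 1) / 2 + i

lemma pidx_lt {i j m : ℕ} (hij : i < j) (hjm : j < m) : pidx i j < m * (m - 1) / 2 := by
  have h1 : pidx i j < j * (j - 1) / 2 + j := by unfold pidx; omega
  have h2 : j * (j - 1) / 2 + j = (j + 1) * j / 2 := by
    obtain ⟨j', rfl⟩ : ∃ j', j = j' + 1 := ⟨j - 1, by omega⟩
    have h : (j' + 2) * (j' + 1) = (j' + 1) * j' + (j' + 1) * 2 := by ring
    simp only [Nat.add_sub_cancel]
    rw [show j' + 1 + 1 = j' + 2 from rfl, h,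
      Nat.add_mul_div_right _ _ (by norm_num : 0 < 2)]
  have h3 : (j + 1) * j ≤ m * (m - 1) := Nat.mul_le_mul (by omega) (by omega)
  have h4 := Nat.div_le_div_right (c := 2) h3
  omega

/-- `T_m`: the `m × 2^(m-1)` matrix whose columns are exactly the `2^(m-1)` vectors of
the form `(1, ±1, …, ±1)`: `T_m(0,j) = 1` and `T_m(i,j) = (-1)^(bit_(i-1)(j))` for
`i ≥ 1`. -/
def Tmat (m : ℕ) : Matrix (Fin m) (Fin (2 ^ (m - 1))) ℝ :=
  fun i j => if i.val = 0 then 1 else if Nat.testBit j.val (i.val - 1) then -1 else 1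

/-- The Sylvester Hadamard matrix `H_{2^k}`, via `H(i,j) = (-1)^popcount(i AND j)`
(the sum of the binary digits of `i &&& j` is its popcount). -/
def Hsyl (k : ℕ) : Matrix (Fin (2 ^ k)) (Fin (2 ^ k)) ℝ :=
  fun i j => (-1) ^ ((Nat.digits 2 (i.val &&& j.val)).sum)

/-- `CT_m`: the `(m(m-1)/2) × 2^(m-1)` matrix whose `k`-th column is the Column
Pairwise Product of the `k`-th column of `T_m`: its entry in the row at position
`pidx i j` (for the unique pair `i < j` with that position) and column `k` is
`T_m i k * T_m j k`. -/
def CTmat (m : ℕ) : Matrix (Fin (m * (m - 1) / 2)) (Fin (2 ^ (m - 1))) ℝ :=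
  fun p k => ∑ i : Fin m, ∑ j : Fin m,
    if i < j ∧ pidx i.val j.val = p.val then Tmat m i k * Tmat m j k else 0

/-- An `m × n` real matrix is `m`-Hadamardesque if every column is a positive multiple
of some column of `T_m`. -/
def IsHadamardesque {m n : ℕ} (M : Matrix (Fin m) (Fin n) ℝ) : Prop :=
  ∀ k : Fin n, ∃ (p : ℝ) (c : Fin (2 ^ (m - 1))), 0 < p ∧ ∀ i, M i k = p * Tmat m i c

/-- The Column Representation Vector of an (`m`-Hadamardesque) matrix `M`: its `c`-th
coordinate is the sum of `p²` over all columns of `M` equal to `p` times the `c`-th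
column of `T_m` with `p > 0` (for such a column, `p` is its first entry, since the
first entry of each column of `T_m` is `1`), and `0` if no column of `M` is a positive
multiple of the `c`-th column of `T_m`. -/
noncomputable def CRV {m n : ℕ} (hm : 0 < m) (M : Matrix (Fin m) (Fin n) ℝ) :
    Fin (2 ^ (m - 1)) → ℝ :=
  fun c => ∑ k : Fin n,
    if 0 < M ⟨0, hm⟩ k ∧ ∀ i, M i k = M ⟨0, hm⟩ k * Tmat m i c then (M ⟨0, hm⟩ k) ^ 2
    else 0

/-- `RC_m`: the set of rows of `H_{2^(m-1)}` that are not rows of `CT_m`. -/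
def RCset (m : ℕ) : Set (Fin (2 ^ (m - 1)) → ℝ) :=
  {w | (∃ a : Fin (2 ^ (m - 1)), w = Hsyl (m - 1) a) ∧
       ¬∃ p : Fin (m * (m - 1) / 2), w = CTmat m p}

/-- The Thue–Morse sign `(-1)^popcount(n)`. -/
def popSign (n : ℕ) : ℝ := (-1) ^ ((Nat.digits 2 n).sum)

lemma popSign_zero : popSign 0 = 1 := by simp [popSign]

lemma popSign_eq_mul_div_two (n : ℕ) : popSign n = (-1) ^ (n % 2) * popSign (n / 2) := by
  rcases Nat.eq_zero_or_pos n with rfl | hn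
  · simp [popSign]
  · rw [popSign, Nat.digits_def' (by norm_num) hn, List.sum_cons, pow_add, popSign]

lemma popSign_xor (x y : ℕ) : popSign (x ^^^ y) = popSign x * popSign y := by
  induction x using Nat.strong_induction_on generalizing y with
  | _ x ih =>
    rcases Nat.eq_zero_or_pos x with rfl | hx
    · simp [popSign_zero]
    · rw [popSign_eq_mul_div_two (x ^^^ y), popSign_eq_mul_div_two x, popSign_eq_mul_div_two y,
        Nat.xor_div_two, ih (x / 2) (by omega), Nat.xor_mod_two_eq]
      rcases Nat.mod_two_eq_zero_or_one x with h | h <;>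
      rcases Nat.mod_two_eq_zero_or_one y with h' | h' <;>
      simp [Nat.add_mod, h, h']

lemma popSign_two_pow (i : ℕ) : popSign (2 ^ i) = -1 := by
  induction i with
  | zero => simp [popSign]
  | succ i ih => rw [popSign_eq_mul_div_two, pow_succ]; simp [ih]

lemma popSign_two_pow_and (i c : ℕ) :
    popSign (2 ^ i &&& c) = if Nat.testBit c i then -1 else 1 := by
  rw [Nat.two_pow_and]
  cases h : c.testBit i <;> simp [popSign_zero, popSign_two_pow]

lemma Hsyl_apply (k : ℕ) (a b : Fin (2 ^ k)) : Hsyl k a b = popSign (a.val &&& b.val) := rfl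

lemma Hsyl_comm (k : ℕ) (a b : Fin (2 ^ k)) : Hsyl k a b = Hsyl k b a := by
  rw [Hsyl_apply, Hsyl_apply, Nat.and_comm]

/-- A nontrivial row of the Sylvester matrix sums to zero. -/
lemma sum_popSign_and (k d : ℕ) (hd : d < 2 ^ k) (hd0 : d ≠ 0) :
    ∑ c : Fin (2 ^ k), popSign (d &&& c.val) = 0 := by
  obtain ⟨i, hi⟩ := Nat.exists_testBit_of_ne_zero hd0
  have hik : 2 ^ i < 2 ^ k := (Nat.ge_two_pow_of_testBit hi).trans_lt hd
  let flip : Fin (2 ^ k) → Fin (2 ^ k) :=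
    fun c => ⟨c.val ^^^ 2 ^ i, Nat.xor_lt_two_pow c.isLt hik⟩
  have hflip : Function.Involutive flip := fun c => Fin.ext (by simp [flip])
  have hneg : ∀ c, popSign (d &&& (flip c).val) = -popSign (d &&& c.val) := fun c => by
    simp only [flip]
    rw [Nat.and_xor_distrib_left, popSign_xor, Nat.and_comm d (2 ^ i), popSign_two_pow_and, hi]
    simp
  have hsum := Equiv.sum_comp hflip.toPerm (fun c : Fin (2 ^ k) => popSign (d &&& c.val))
  simp only [Function.Involutive.coe_toPerm, hneg, Finset.sum_neg_distrib] at hsum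
  linarith

lemma Hsyl_dotProduct (k : ℕ) (a b : Fin (2 ^ k)) :
    Hsyl k a ⬝ᵥ Hsyl k b = if a = b then 2 ^ k else 0 := by
  have h : Hsyl k a ⬝ᵥ Hsyl k b = ∑ c : Fin (2 ^ k), popSign ((a.val ^^^ b.val) &&& c.val) := by
    refine Finset.sum_congr rfl fun c _ => ?_
    rw [Hsyl_apply, Hsyl_apply, ← popSign_xor, ← Nat.and_xor_distrib_right]
  rw [h]
  split_ifs with hab
  · simp [hab, popSign_zero]
  · refine sum_popSign_and k _ (Nat.xor_lt_two_pow a.isLt b.isLt) fun h0 => hab (Fin.ext ?_)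
    exact Nat.xor_eq_zero_iff.mp h0

/-- Fourier inversion for the Sylvester matrix. -/
lemma eq_sum_Hsyl_dotProduct_smul (k : ℕ) (u : Fin (2 ^ k) → ℝ) :
    u = ∑ a, ((2 ^ k : ℝ)⁻¹ * (Hsyl k a ⬝ᵥ u)) • Hsyl k a := by
  ext c
  have h : ∀ d, ∑ a, Hsyl k a d * Hsyl k a c = if d = c then 2 ^ k else 0 := fun d => by
    rw [← Hsyl_dotProduct]
    exact Finset.sum_congr rfl fun a _ => by rw [Hsyl_comm k a d, Hsyl_comm k a c]
  calc u c = (2 ^ k : ℝ)⁻¹ * ∑ d, u d * ∑ a, Hsyl k a d * Hsyl k a c := by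
        simp [h, mul_comm (u c)]
    _ = _ := by
        simp only [Finset.sum_apply, Pi.smul_apply, smul_eq_mul, dotProduct, Finset.mul_sum,
          Finset.sum_mul]
        rw [Finset.sum_comm]
        exact Finset.sum_congr rfl fun a _ => Finset.sum_congr rfl fun d _ => by ring

/-- Each row of `T_m` is a row of the Sylvester matrix. -/
lemma exists_Tmat_eq_popSign (m : ℕ) (i : Fin m) :
    ∃ t < 2 ^ (m - 1), ∀ c, Tmat m i c = popSign (t &&& c.val) := by
  by_cases hi : i.val = 0
  · exact ⟨0, by positivity, fun c => by simp [Tmat, hi, popSign_zero]⟩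
  · refine ⟨2 ^ (i.val - 1), Nat.pow_lt_pow_right (by norm_num) (by omega), fun c => ?_⟩
    simp [Tmat, hi, popSign_two_pow_and]

lemma exists_Tmat_mul_Tmat_eq_Hsyl (m : ℕ) (i j : Fin m) :
    ∃ b, Tmat m i * Tmat m j = Hsyl (m - 1) b := by
  obtain ⟨s, hs, hsT⟩ := exists_Tmat_eq_popSign m i
  obtain ⟨t, ht, htT⟩ := exists_Tmat_eq_popSign m j
  refine ⟨⟨s ^^^ t, Nat.xor_lt_two_pow hs ht⟩, funext fun c => ?_⟩
  rw [Pi.mul_apply, hsT, htT, Hsyl_apply, ← popSign_xor, ← Nat.and_xor_distrib_right]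

lemma Tmat_col_injective {m : ℕ} {c d : Fin (2 ^ (m - 1))}
    (h : ∀ i, Tmat m i c = Tmat m i d) : c = d := by
  refine Fin.ext (Nat.eq_of_testBit_eq fun i => ?_)
  by_cases hi : i < m - 1
  · have hT := h ⟨i + 1, by omega⟩
    simp only [Tmat, Nat.add_eq_zero_iff, one_ne_zero, and_false, if_false,
      Nat.add_sub_cancel] at hT
    cases hc : c.val.testBit i <;> cases hd : d.val.testBit i <;> simp [hc, hd] at hT ⊢ <;>
      norm_num at hT
  · have hle : 2 ^ (m - 1) ≤ 2 ^ i := Nat.pow_le_pow_right (by norm_num) (by omega)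
    rw [Nat.testBit_eq_false_of_lt (c.isLt.trans_le hle),
      Nat.testBit_eq_false_of_lt (d.isLt.trans_le hle)]

lemma pidx_injective {i j i' j' : ℕ} (h : i < j) (h' : i' < j') (he : pidx i j = pidx i' j') :
    i = i' ∧ j = j' := by
  have hj : j = j' := by
    rcases lt_trichotomy j j' with hlt | heq | hlt
    · have := pidx_lt h hlt
      unfold pidx at *
      omega
    · exact heq
    · have := pidx_lt h' hlt
      unfold pidx at *
      omega
  subst hj
  unfold pidx at he
  omega

lemma CTmat_pidx {m : ℕ} {i j : Fin m} (hij : i < j) :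
    CTmat m ⟨pidx i j, pidx_lt hij j.isLt⟩ = Tmat m i * Tmat m j := by
  ext c
  have hiff : ∀ i' j' : Fin m,
      (i' < j' ∧ pidx i'.val j'.val = pidx i.val j.val) ↔ (i' = i ∧ j' = j) := by
    refine fun i' j' => ⟨fun ⟨hlt, he⟩ => ?_, fun ⟨hi, hj⟩ => by subst hi hj; exact ⟨hij, rfl⟩⟩
    have := pidx_injective hlt hij he
    exact ⟨Fin.ext this.1, Fin.ext this.2⟩
  simp only [CTmat, hiff, ite_and, Pi.mul_apply]
  simp

/-- Row dot products are determined by the Column Representation Vector. -/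
lemma CRV_dotProduct_Tmat_mul {m n : ℕ} (hm : 0 < m) {M : Matrix (Fin m) (Fin n) ℝ}
    (hM : IsHadamardesque M) (i j : Fin m) :
    (Tmat m i * Tmat m j) ⬝ᵥ CRV hm M = M i ⬝ᵥ M j := by
  simp only [dotProduct, CRV, Finset.mul_sum]
  rw [Finset.sum_comm]
  refine Finset.sum_congr rfl fun k _ => ?_
  obtain ⟨p, c, hp, hc⟩ := hM k
  have h0 : M ⟨0, hm⟩ k = p := by rw [hc]; simp [Tmat]
  have hiff : ∀ d, (0 < M ⟨0, hm⟩ k ∧ ∀ i, M i k = M ⟨0, hm⟩ k * Tmat m i d) ↔ d = c := by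
    refine fun d => ⟨fun ⟨_, h⟩ => Tmat_col_injective fun i => ?_, fun h => ?_⟩
    · have := h i
      rw [h0, hc] at this
      exact (mul_left_cancel₀ hp.ne' this).symm
    · subst h
      rw [h0]
      exact ⟨hp, hc⟩
  simp only [hiff]
  simp only [h0, mul_ite, mul_zero, Finset.sum_ite_eq', Finset.mem_univ, if_true,
    Pi.mul_apply, hc i, hc j]
  ring

/-- The span of `RC_m` is the kernel of `CT_m`. -/
lemma mem_span_RCset_iff (m : ℕ) (u : Fin (2 ^ (m - 1)) → ℝ) :
    u ∈ Submodule.span ℝ (RCset m) ↔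
      ∀ i j : Fin m, i < j → (Tmat m i * Tmat m j) ⬝ᵥ u = 0 := by
  constructor
  · intro hu i j hij
    induction hu using Submodule.span_induction with
    | mem w hw =>
      obtain ⟨⟨a, rfl⟩, hCT⟩ := hw
      obtain ⟨b, hb⟩ := exists_Tmat_mul_Tmat_eq_Hsyl m i j
      rw [hb, Hsyl_dotProduct, if_neg]
      rintro rfl
      exact hCT ⟨_, hb.symm.trans (CTmat_pidx hij).symm⟩
    | zero => simp
    | add x y _ _ hx hy => rw [dotProduct_add, hx, hy, add_zero]
    | smul r x _ hx => rw [dotProduct_smul, hx, smul_zero]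
  · intro hu
    rw [eq_sum_Hsyl_dotProduct_smul (m - 1) u]
    refine Submodule.sum_mem _ fun a _ => ?_
    by_cases ha : ∃ p, Hsyl (m - 1) a = CTmat m p
    · obtain ⟨p, hp⟩ := ha
      have hCT : CTmat m p = ∑ i : Fin m, ∑ j : Fin m,
          if i < j ∧ pidx i.val j.val = p.val then Tmat m i * Tmat m j else 0 := by
        ext c
        simp only [CTmat, Finset.sum_apply]
        refine Finset.sum_congr rfl fun i _ => Finset.sum_congr rfl fun j _ => ?_
        split_ifs <;> rfl
      have hzero : Hsyl (m - 1) a ⬝ᵥ u = 0 := by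
        rw [hp, hCT]
        simp only [sum_dotProduct]
        refine Finset.sum_eq_zero fun i _ => Finset.sum_eq_zero fun j _ => ?_
        split_ifs with hij
        · exact hu i j hij.1
        · exact zero_dotProduct u
      rw [hzero, mul_zero, zero_smul]
      exact Submodule.zero_mem _
    · exact Submodule.smul_mem _ _ (Submodule.subset_span ⟨⟨a, rfl⟩, ha⟩)

/-- For `m ≥ 2` and `m`-Hadamardesque matrices `M`, `M'` with Column Representation
Vectors `v`, `v'`: `M` and `M'` have the same pairwise row dot products iff `v - v'`
lies in the span of `RC_m`. -/
theorem same_rowdots_iff_crv_diff_mem_span (m n n' : ℕ) (hm : 2 ≤ m)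
    (M : Matrix (Fin m) (Fin n) ℝ) (M' : Matrix (Fin m) (Fin n') ℝ)
    (hM : IsHadamardesque M) (hM' : IsHadamardesque M') :
    (∀ i j : Fin m, i < j → M i ⬝ᵥ M j = M' i ⬝ᵥ M' j) ↔
      CRV (by omega : 0 < m) M - CRV (by omega : 0 < m) M'
        ∈ Submodule.span ℝ (RCset m) := by
  rw [mem_span_RCset_iff]
  refine forall_congr' fun i => forall_congr' fun j => imp_congr_right fun _ => ?_
  rw [dotProduct_sub, CRV_dotProduct_Tmat_mul _ hM, CRV_dotProduct_Tmat_mul _ hM', sub_eq_zero]
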